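/- Let K be a graph consisting of pairwise disjoint connected graphs S_1,…,S_r together with an additional vertex u adjacent to exactly one vertex v_j in each S_j (and no other edges). If for some h ∈ [r] we have minrk_q(S_h − v_h) = minrk_q(S_h) − 1, then minrk_q(K) = Σ_{j=1}^r minrk_q(S_j). -/

import Mathlib

open scoped Classical

/-- A matrix `M` fits the graph `G` if its diagonal entries are nonzero and its
entries at distinct non-adjacent pairs of vertices are zero. -/
def Fits {V F : Type} [Fintype V] [Field F]
    (G : SimpleGraph V) (M : Matrix V V F) : Prop :=
  (∀ u, M u u ≠ 0) ∧ ∀ u v, u ≠ v → ¬ G.Adj u v → M u v = 0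

/-- The min-rank of `G` over the field `F`: the minimum rank of a matrix fitting `G`. -/
noncomputable def minrk (F : Type) [Field F] {V : Type} [Fintype V]
    (G : SimpleGraph V) : ℕ :=
  sInf {r : ℕ | ∃ M : Matrix V V F, Fits G M ∧ M.rank = r}

theorem rank_block {ι F : Type} [Fintype ι] [Field F] {T : ι → Type} [∀ i, Fintype (T i)]
    (B : Matrix (Σ i, T i) (Σ i, T i) F)
    (hB : ∀ i j (a : T i) (b : T j), i ≠ j → B ⟨i, a⟩ ⟨j, b⟩ = 0) :
    B.rank = ∑ i, (B.submatrix (Sigma.mk i) (Sigma.mk i)).rank := by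
  have key : ∀ (y : (Σ i, T i) → F) (i : ι) (a : T i), B.mulVec y ⟨i, a⟩ =
      (B.submatrix (Sigma.mk i) (Sigma.mk i)).mulVec (fun b => y ⟨i, b⟩) a := by
    intro y i a
    simp only [Matrix.mulVec, dotProduct, Matrix.submatrix_apply]
    rw [Fintype.sum_sigma, Finset.sum_eq_single i]
    · intro j _ hj
      exact Finset.sum_eq_zero fun b _ => by rw [hB i j a b hj.symm, zero_mul]
    · simp
  let f : (Π i, LinearMap.range (B.submatrix (Sigma.mk i) (Sigma.mk i)).mulVecLin) →ₗ[F]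
      ((Σ i, T i) → F) :=
    { toFun := fun x p => (x p.1).1 p.2
      map_add' := fun x y => rfl
      map_smul' := fun c x => rfl }
  have hf : Function.Injective f := by
    intro x y hxy
    funext i
    apply Subtype.ext
    funext a
    exact congrFun hxy ⟨i, a⟩
  have hr : LinearMap.range B.mulVecLin = LinearMap.range f := by
    ext z
    constructor
    · rintro ⟨y, rfl⟩
      refine ⟨fun i => ⟨_, ⟨fun b => y ⟨i, b⟩, rfl⟩⟩, ?_⟩
      funext ⟨i, a⟩
      exact (key y i a).symm
    · rintro ⟨x, rfl⟩
      have hx : ∀ i, ∃ y, (B.submatrix (Sigma.mk i) (Sigma.mk i)).mulVecLin y = (x i).1 :=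
        fun i => (x i).2
      choose y hy using hx
      refine ⟨fun p => y p.1 p.2, ?_⟩
      funext ⟨i, a⟩
      refine (key _ i a).trans ?_
      exact congrFun (hy i) a
  unfold Matrix.rank
  rw [hr, LinearMap.finrank_range_of_inj hf, Module.finrank_pi_fintype]

theorem fits_one {V F : Type} [Fintype V] [Field F] (G : SimpleGraph V) :
    Fits G (1 : Matrix V V F) :=
  ⟨fun u => by simp, fun u v h _ => Matrix.one_apply_ne h⟩

theorem minrk_spec (F : Type) [Field F] {V : Type} [Fintype V] (G : SimpleGraph V) :
    ∃ M : Matrix V V F, Fits G M ∧ M.rank = minrk F G :=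
  Nat.sInf_mem (s := {r : ℕ | ∃ M : Matrix V V F, Fits G M ∧ M.rank = r})
    ⟨_, 1, fits_one G, rfl⟩

theorem minrk_le {F : Type} [Field F] {V : Type} [Fintype V] {G : SimpleGraph V}
    {M : Matrix V V F} (h : Fits G M) : minrk F G ≤ M.rank :=
  Nat.sInf_le ⟨M, h, rfl⟩

theorem minrk_lower {ι V F : Type} [Fintype ι] [Fintype V] [Field F] (G : SimpleGraph V)
    (T : ι → Set V) [∀ i, Fintype (T i)]
    (hdisj : ∀ i j, i ≠ j → Disjoint (T i) (T j))
    (hno : ∀ i j, i ≠ j → ∀ a ∈ T i, ∀ b ∈ T j, ¬ G.Adj a b) :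
    ∑ i, minrk F (G.induce (T i)) ≤ minrk F G := by
  obtain ⟨M, hM, hr⟩ := minrk_spec F G
  rw [← hr]
  let e : (Σ i, T i) → V := fun p => p.2.1
  refine le_trans ?_ (Matrix.rank_submatrix_le M e e)
  rw [rank_block]
  · refine Finset.sum_le_sum fun i _ => minrk_le ⟨fun a => hM.1 _, fun a b hab h => ?_⟩
    exact hM.2 _ _ (fun h' => hab (Subtype.ext h')) h
  · intro i j a b hij
    exact hM.2 _ _ (fun h => (Set.disjoint_left.1 (hdisj i j hij) a.2)
      (by have h : a.1 = b.1 := h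
          rw [h]; exact b.2)) (hno i j hij _ a.2 _ b.2)

theorem minrk_upper {ι V F : Type} [Fintype ι] [Fintype V] [Field F] (G : SimpleGraph V)
    (T : ι → Set V) [∀ i, Fintype (T i)]
    (hdisj : ∀ i j, i ≠ j → Disjoint (T i) (T j))
    (hcov : ∀ a, ∃ i, a ∈ T i) :
    minrk F G ≤ ∑ i, minrk F (G.induce (T i)) := by
  choose M hM hr using fun i => minrk_spec F (G.induce (T i))
  let e : (Σ i, T i) ≃ V := Equiv.ofBijective (fun p => p.2.1) (by
    constructor
    · rintro ⟨i, a, ha⟩ ⟨j, b, hb⟩ h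
      have h : a = b := h
      subst h
      have : i = j := by
        by_contra hij
        exact Set.disjoint_left.1 (hdisj i j hij) ha hb
      subst this
      rfl
    · intro a
      obtain ⟨i, hi⟩ := hcov a
      exact ⟨⟨i, a, hi⟩, rfl⟩)
  have he : ∀ i (a : T i), e ⟨i, a⟩ = a.1 := fun _ _ => rfl
  let B := Matrix.blockDiagonal' M
  have hfit : Fits G (B.submatrix e.symm e.symm) := by
    constructor
    · intro w
      obtain ⟨⟨i, a⟩, rfl⟩ := e.surjective w
      simp only [Matrix.submatrix_apply, Equiv.symm_apply_apply, B, Matrix.blockDiagonal'_apply_eq]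
      exact (hM i).1 a
    · intro w w' hw hadj
      obtain ⟨⟨i, a⟩, rfl⟩ := e.surjective w
      obtain ⟨⟨j, b⟩, rfl⟩ := e.surjective w'
      simp only [Matrix.submatrix_apply, Equiv.symm_apply_apply, B]
      by_cases hij : i = j
      · subst hij
        rw [Matrix.blockDiagonal'_apply_eq]
        exact (hM i).2 a b (fun h => hw (by rw [h])) hadj
      · exact Matrix.blockDiagonal'_apply_ne _ _ _ hij
  refine (minrk_le hfit).trans ?_
  rw [Matrix.rank_submatrix, rank_block]
  · refine Finset.sum_le_sum fun i _ => ?_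
    rw [← hr i]
    apply le_of_eq
    congr 1
    ext a b
    simp [B]
  · intro i j a b hij
    exact Matrix.blockDiagonal'_apply_ne _ _ _ hij

theorem minrk_pos {F : Type} [Field F] {V : Type} [Fintype V] (G : SimpleGraph V) (a : V) :
    1 ≤ minrk F G := by
  obtain ⟨M, hM, hr⟩ := minrk_spec F G
  rw [← hr]
  by_contra h
  have h0 : M.rank = 0 := by omega
  unfold Matrix.rank at h0
  have h1 := Submodule.finrank_eq_zero.1 h0
  rw [LinearMap.range_eq_bot] at h1
  apply hM.1 a
  have := congrFun (LinearMap.congr_fun h1 (Pi.single a 1)) a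
  simpa using this

theorem minrk_pair {F : Type} [Field F] {V : Type} [Fintype V] (G : SimpleGraph V)
    (h : ∀ a b, a ≠ b → G.Adj a b) : minrk F G ≤ 1 := by
  have hf : Fits G (Matrix.vecMulVec (fun _ => 1) (fun _ => 1) : Matrix V V F) :=
    ⟨fun u => by simp [Matrix.vecMulVec_apply], fun u v huv hn => absurd (h u v huv) hn⟩
  exact (minrk_le hf).trans (Matrix.rank_vecMulVec_le _ _)

theorem minrk_star_of_branches_of_drop {W F : Type} [Fintype W] [Field F] [Fintype F]
    (G : SimpleGraph W) (r : ℕ) (S : Fin r → Set W) (u : W) (v : Fin r → W)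
    (hdisj : ∀ i j, i ≠ j → Disjoint (S i) (S j))
    (hu : ∀ j, u ∉ S j)
    (hv : ∀ j, v j ∈ S j)
    (hcover : {u} ∪ (⋃ j, S j) = Set.univ)
    (hconn : ∀ j, (G.induce (S j)).Connected)
    (hadj : ∀ j, G.Adj u (v j))
    (hedges : ∀ a b, G.Adj a b →
      (∃ j, a ∈ S j ∧ b ∈ S j) ∨ (a = u ∧ ∃ j, b = v j) ∨ (b = u ∧ ∃ j, a = v j))
    (hdrop : ∃ h : Fin r,
      minrk F (G.induce (S h \ {v h})) = minrk F (G.induce (S h)) - 1) :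
    minrk F G = ∑ j, minrk F (G.induce (S j)) := by
  have hno : ∀ i j, i ≠ j → ∀ a ∈ S i, ∀ b ∈ S j, ¬ G.Adj a b := by
    intro i j hij a ha b hb hab
    rcases hedges a b hab with ⟨k, hak, hbk⟩ | ⟨rfl, _⟩ | ⟨rfl, _⟩
    · by_cases hik : i = k
      · subst hik
        exact Set.disjoint_left.1 (hdisj i j hij) hbk hb
      · exact Set.disjoint_left.1 (hdisj i k hik) ha hak
    · exact hu i ha
    · exact hu j hb
  apply le_antisymm
  · obtain ⟨h, hh⟩ := hdrop
    let T : Option (Fin r) → Set W := fun o => o.elim {u, v h} (fun j => S j \ {v h})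
    have hn : ∀ j, Disjoint (T none) (T (some j)) := by
      intro j
      rw [Set.disjoint_left]
      rintro a (rfl | rfl) hb
      · exact hu j hb.1
      · exact hb.2 rfl
    have hup := minrk_upper (F := F) G T (by
      rintro (_ | i) (_ | j) hij
      · exact absurd rfl hij
      · exact hn j
      · exact (hn i).symm
      · exact (hdisj i j (fun h => hij (by rw [h]))).mono Set.diff_subset Set.diff_subset) (by
      intro a
      by_cases hav : a = v h
      · exact ⟨none, Or.inr hav⟩
      have : a ∈ {u} ∪ (⋃ j, S j) := by rw [hcover]; trivial
      rcases this with h1 | h1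
      · exact ⟨none, Or.inl h1⟩
      · obtain ⟨j, hj⟩ := Set.mem_iUnion.1 h1
        exact ⟨some j, hj, hav⟩)
    rw [Fintype.sum_option] at hup
    have h1 : minrk F (G.induce (T none)) ≤ 1 := by
      apply minrk_pair
      rintro ⟨a, ha⟩ ⟨b, hb⟩ hab
      have hab' : a ≠ b := fun h => hab (Subtype.ext h)
      change G.Adj a b
      rcases ha with rfl | rfl <;> rcases hb with rfl | rfl
      · exact absurd rfl hab'
      · exact hadj h
      · exact (hadj h).symm
      · exact absurd rfl hab'
    have h2 : ∀ j, j ≠ h → minrk F (G.induce (T (some j))) = minrk F (G.induce (S j)) := by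
      intro j hj
      have : T (some j) = S j := by
        ext a
        refine ⟨fun x => x.1, fun x => ⟨x, ?_⟩⟩
        rintro rfl
        exact Set.disjoint_left.1 (hdisj j h hj) x (hv h)
      rw! [this]
      congr!
    have h3 : minrk F (G.induce (T (some h))) = minrk F (G.induce (S h)) - 1 := by
      rw [← hh]
      congr!
    have h4 := minrk_pos (F := F) (G.induce (S h)) ⟨v h, hv h⟩
    rw [← Finset.add_sum_erase _ _ (Finset.mem_univ h), h3,
      Finset.sum_congr rfl (fun j hj => h2 j (Finset.ne_of_mem_erase hj))] at hup
    rw [← Finset.add_sum_erase _ _ (Finset.mem_univ h)]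
    omega
  · exact minrk_lower G S hdisj hno
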